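/- Let r ≥ 2 and let T be a tree on n ≥ 2r vertices with radius r. Then H(T) ≤ H(C_{n,2r−1,r−1}), with equality if and only if T is isomorphic to C_{n,2r−1,r−1}. -/

import Mathlib

open Finset SimpleGraph

open Classical in
/-- The Harary index: half the sum, over ordered pairs of distinct vertices, of the
reciprocal of the shortest-path distance (so each unordered pair is counted once). -/
noncomputable def harary {V : Type*} [Fintype V] (G : SimpleGraph V) : ℝ :=
  (∑ u : V, ∑ v : V, if u = v then 0 else (1 : ℝ) / (G.dist u v)) / 2

/-- The path graph `P_n` on `n` vertices. -/
def pathG (n : ℕ) : SimpleGraph (Fin n) :=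
  SimpleGraph.fromRel (fun x y => (y : ℕ) = (x : ℕ) + 1)

/-- The star graph `S_n` on `n` vertices, with center `0`. -/
def starG (n : ℕ) : SimpleGraph (Fin n) :=
  SimpleGraph.fromRel (fun x y => (x : ℕ) = 0 ∧ (y : ℕ) ≠ 0)

/-- The spider (starlike tree) `S(L 0, …, L (k-1))`: a center `none` together with `k`
disjoint paths, the `i`-th having `L i` vertices, the center joined to vertex `0` of each leg. -/
def spider {k : ℕ} (L : Fin k → ℕ) : SimpleGraph (Option (Σ i : Fin k, Fin (L i))) :=
  SimpleGraph.fromRel (fun x y =>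
    (∃ (i : Fin k) (j : Fin (L i)), x = none ∧ y = some ⟨i, j⟩ ∧ (j : ℕ) = 0) ∨
    (∃ (i : Fin k) (j j' : Fin (L i)),
      x = some ⟨i, j⟩ ∧ y = some ⟨i, j'⟩ ∧ (j' : ℕ) = (j : ℕ) + 1))

/-- Leg lengths of the balanced starlike tree `BS n k`: the legs sum to `n - 1` and
pairwise differ by at most `1`. -/
def balancedLegs (n k : ℕ) : Fin k → ℕ :=
  fun i => (n - 1) / k + if (i : ℕ) < (n - 1) % k then 1 else 0

/-- The balanced starlike tree `BS_{n,k}` on `n` vertices with `k` legs of almost equal length. -/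
def BS (n k : ℕ) : SimpleGraph (Option (Σ i : Fin k, Fin (balancedLegs n k i))) :=
  spider (balancedLegs n k)

/-- Leg lengths of the broom `B_{n,k}`: one leg with `n - k` vertices, `k - 1` legs with one. -/
def broomLegs (n k : ℕ) : Fin k → ℕ := fun i => if (i : ℕ) = 0 then n - k else 1

/-- The broom `B_{n,k} = S(n-k, 1, …, 1)`. -/
def broom (n k : ℕ) : SimpleGraph (Option (Σ i : Fin k, Fin (broomLegs n k i))) :=
  spider (broomLegs n k)

/-- Leg lengths of the spur `A_{n,m}`: `n - m - 1` legs with two vertices, the rest with one. -/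
def spurLegs (n m : ℕ) : Fin m → ℕ := fun i => if (i : ℕ) < n - m - 1 then 2 else 1

/-- The spur `A_{n,m}`: the star `S_{m+1}` with a pendent edge attached to `n - m - 1`
of its pendent vertices. -/
def spur (n m : ℕ) : SimpleGraph (Option (Σ i : Fin m, Fin (spurLegs n m i))) :=
  spider (spurLegs n m)

/-- The caterpillar `C_{n,d,i}`: a path `v_0 v_1 … v_d` with `n - d - 1` pendent
vertices attached at `v_i`. -/
def caterpillar (n d i : ℕ) : SimpleGraph (Fin (d + 1) ⊕ Fin (n - d - 1)) :=
  SimpleGraph.fromRel (fun x y =>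
    (∃ a b : Fin (d + 1), x = Sum.inl a ∧ y = Sum.inl b ∧ (b : ℕ) = (a : ℕ) + 1) ∨
    (∃ (a : Fin (d + 1)) (p : Fin (n - d - 1)), (a : ℕ) = i ∧ x = Sum.inl a ∧ y = Sum.inr p))

/-- Degree of a vertex. -/
noncomputable def deg {V : Type*} [Fintype V] (G : SimpleGraph V) (v : V) : ℕ :=
  (G.neighborSet v).ncard

/-- Eccentricity of a vertex: the maximum distance to another vertex. -/
noncomputable def ecc {V : Type*} [Fintype V] (G : SimpleGraph V) (v : V) : ℕ :=
  Finset.univ.sup fun u => G.dist v u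

/-- Diameter of a graph: the maximum eccentricity. -/
noncomputable def graphDiam {V : Type*} [Fintype V] (G : SimpleGraph V) : ℕ :=
  Finset.univ.sup fun v => ecc G v

/-- Radius of a graph: the minimum eccentricity. -/
noncomputable def graphRadius {V : Type*} [Fintype V] (G : SimpleGraph V) : ℕ :=
  sInf (Set.range fun v => ecc G v)

/-- Matching number: the maximum cardinality of a set of pairwise non-incident edges. -/
noncomputable def matchingNumber {V : Type*} [Fintype V] (G : SimpleGraph V) : ℕ :=
  sSup {k | ∃ M : Finset (Sym2 V), M.card = k ∧ (∀ e ∈ M, e ∈ G.edgeSet) ∧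
    ∀ e ∈ M, ∀ f ∈ M, e ≠ f → ∀ v : V, ¬(v ∈ e ∧ v ∈ f)}

/-- Independence number: the maximum cardinality of a set of pairwise non-adjacent vertices. -/
noncomputable def indepNum {V : Type*} [Fintype V] (G : SimpleGraph V) : ℕ :=
  sSup {k | ∃ s : Finset V, s.card = k ∧ ∀ u ∈ s, ∀ v ∈ s, u ≠ v → ¬ G.Adj u v}


/-! ### Sums of reciprocal distances along a path -/

/-- The sum of `1 / (h + |i - j|)` over `i < N`. -/
noncomputable def recipSum (N j h : ℕ) : ℝ :=
  ∑ i ∈ range N, 1 / ((h + Nat.dist i j : ℕ) : ℝ)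

theorem recipSum_eq (j k h : ℕ) : recipSum (j + k + 1) j h =
    1 / (h : ℝ) + ∑ t ∈ range j, 1 / ((h + t + 1 : ℕ) : ℝ) +
      ∑ t ∈ range k, 1 / ((h + t + 1 : ℕ) : ℝ) := by
  have hN : j + k + 1 = j + (k + 1) := by ring
  rw [recipSum, hN, sum_range_add, sum_range_succ' _ k, ← sum_range_reflect]
  have h₁ : ∀ t ∈ range j, 1 / ((h + Nat.dist (j - 1 - t) j : ℕ) : ℝ) =
      1 / ((h + t + 1 : ℕ) : ℝ) := by
    intro t ht
    rw [mem_range] at ht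
    rw [show h + Nat.dist (j - 1 - t) j = h + t + 1 by unfold Nat.dist; omega]
  have h₂ : ∀ t ∈ range k, 1 / ((h + Nat.dist (j + (t + 1)) j : ℕ) : ℝ) =
      1 / ((h + t + 1 : ℕ) : ℝ) := by
    intro t _
    rw [show h + Nat.dist (j + (t + 1)) j = h + t + 1 by unfold Nat.dist; omega]
  rw [sum_congr rfl h₁, sum_congr rfl h₂]
  simp
  ring

theorem recipSum_anti {N j h h' : ℕ} (hpos : 0 < h) (hle : h ≤ h') :
    recipSum N j h' ≤ recipSum N j h := by
  refine sum_le_sum fun i _ => one_div_le_one_div_of_le ?_ ?_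
  · exact_mod_cast Nat.add_pos_left hpos _
  · exact_mod_cast Nat.add_le_add_right hle _

theorem recipSum_comm (j k h : ℕ) :
    recipSum (j + k + 1) j h = recipSum (j + k + 1) k h := by
  rw [recipSum_eq, add_comm j k, recipSum_eq]
  ring

/-- Moving the base point towards the middle of the path increases the sum. -/
theorem recipSum_lt_of_lt {j k s : ℕ} (hlt : j + s < k) :
    recipSum (j + s + k + 2) j 1 < recipSum (j + s + k + 2) (j + s + 1) 1 := by
  induction s generalizing k with
  | zero =>
    rw [show j + 0 + k + 2 = j + (k + 1) + 1 by ring, recipSum_eq,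
      show j + (k + 1) + 1 = (j + 1) + k + 1 by ring, Nat.add_zero, recipSum_eq,
      sum_range_succ _ k, sum_range_succ _ j]
    have : 1 / ((1 + k + 1 : ℕ) : ℝ) < 1 / ((1 + j + 1 : ℕ) : ℝ) := by
      apply one_div_lt_one_div_of_lt
      · positivity
      · exact_mod_cast (by omega : 1 + j + 1 < 1 + k + 1)
    linarith
  | succ s ih =>
    have h₁ := ih (k := k + 1) (by omega)
    rw [show j + s + (k + 1) + 2 = j + (s + 1) + k + 2 by ring] at h₁
    refine h₁.trans ?_
    rw [show j + (s + 1) + k + 2 = (j + s + 1) + (k + 1) + 1 by ring, recipSum_eq,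
      show (j + s + 1) + (k + 1) + 1 = (j + (s + 1) + 1) + k + 1 by ring, recipSum_eq,
      sum_range_succ _ k, sum_range_succ _ (j + (s + 1)), ← add_assoc j s 1]
    have : 1 / ((1 + k + 1 : ℕ) : ℝ) < 1 / ((1 + (j + s + 1) + 1 : ℕ) : ℝ) := by
      apply one_div_lt_one_div_of_lt
      · positivity
      · exact_mod_cast (by omega : 1 + (j + s + 1) + 1 < 1 + k + 1)
    linarith

theorem recipSum_middle {r : ℕ} (hr : 1 ≤ r) :
    recipSum (2 * r) r 1 = recipSum (2 * r) (r - 1) 1 := by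
  obtain ⟨q, rfl⟩ := Nat.exists_eq_add_of_le' hr
  have := recipSum_comm (q + 1) q 1
  rwa [show q + 1 + q + 1 = 2 * (q + 1) by ring] at this

theorem recipSum_lt_middle {r j : ℕ} (hr : 1 ≤ r) (hj : j < 2 * r) (h₁ : j ≠ r - 1)
    (h₂ : j ≠ r) : recipSum (2 * r) j 1 < recipSum (2 * r) (r - 1) 1 := by
  rcases lt_or_gt_of_ne h₁ with hlt | hgt
  · obtain ⟨s, hs⟩ := Nat.exists_eq_add_of_lt hlt
    have := recipSum_lt_of_lt (j := j) (k := r) (s := s) (by omega)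
    rwa [← hs, show j + s + r + 2 = 2 * r by omega] at this
  · obtain ⟨k, hk⟩ := Nat.exists_eq_add_of_lt hj
    obtain ⟨s, hs⟩ := Nat.exists_eq_add_of_lt (show k < r - 1 by omega)
    have := recipSum_lt_of_lt (j := k) (k := r) (s := s) (by omega)
    rwa [← hs, show k + s + r + 2 = 2 * r by omega, show 2 * r = k + j + 1 by omega,
      recipSum_comm k j, show k + j + 1 = 2 * r by omega] at this

theorem recipSum_le_middle {r j : ℕ} (hr : 1 ≤ r) (hj : j < 2 * r) :
    recipSum (2 * r) j 1 ≤ recipSum (2 * r) (r - 1) 1 := by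
  by_cases h₁ : j = r - 1
  · rw [h₁]
  by_cases h₂ : j = r
  · rw [h₂, recipSum_middle hr]
  exact (recipSum_lt_middle hr hj h₁ h₂).le

theorem sum_range_shift_one (n : ℕ) : ∑ t ∈ range n, 1 / ((2 + t + 1 : ℕ) : ℝ) =
    ∑ t ∈ range n, 1 / ((1 + t + 1 : ℕ) : ℝ) - 1 / 2 + 1 / ((n + 2 : ℕ) : ℝ) := by
  induction n with
  | zero => norm_num
  | succ n ih =>
    rw [sum_range_succ, sum_range_succ, ih, show 1 + n + 1 = n + 2 by ring,
      show 2 + n + 1 = n + 1 + 2 by ring]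
    ring

theorem recipSum_two_add_half_lt {j k : ℕ} (hjk : 1 ≤ j + k) :
    recipSum (j + k + 1) j 2 + 1 / 2 < recipSum (j + k + 1) j 1 := by
  rw [recipSum_eq, recipSum_eq, sum_range_shift_one, sum_range_shift_one]
  have hhalf : ∀ n : ℕ, 1 / ((n + 2 : ℕ) : ℝ) ≤ 1 / 2 := fun n => by
    apply one_div_le_one_div_of_le two_pos
    push_cast
    linarith [n.cast_nonneg (α := ℝ)]
  have hthird : ∀ n : ℕ, 1 ≤ n → 1 / ((n + 2 : ℕ) : ℝ) ≤ 1 / 3 := fun n hn => by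
    apply one_div_le_one_div_of_le three_pos
    push_cast
    linarith [show (1 : ℝ) ≤ n by exact_mod_cast hn]
  have hj := hhalf j
  have hk := hhalf k
  rcases Nat.eq_zero_or_pos j with h | h
  · have := hthird k (by omega)
    push_cast at *
    linarith
  · have := hthird j h
    push_cast at *
    linarith

/-- A vertex at distance `h ≥ 2` from the path contributes too little, even after it is credited
with the edge to its predecessor. -/
theorem recipSum_add_half_lt_middle {r j h : ℕ} (hr : 1 ≤ r) (hj : j < 2 * r) (hh : 2 ≤ h) :
    recipSum (2 * r) j h + 1 / 2 < recipSum (2 * r) (r - 1) 1 := by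
  obtain ⟨k, hk⟩ := Nat.exists_eq_add_of_lt hj
  have h₁ := recipSum_two_add_half_lt (j := j) (k := k) (by omega)
  rw [← hk] at h₁
  linarith [recipSum_anti (N := 2 * r) (j := j) two_pos hh, recipSum_le_middle hr hj]

/-! ### Distances in trees -/

/-- An integer sequence with steps `±1` and without interior peaks decreases and then increases. -/
theorem exists_eq_add_natDist {a : ℕ → ℕ} {N : ℕ}
    (hstep : ∀ i < N, a (i + 1) = a i + 1 ∨ a i = a (i + 1) + 1)
    (hpeak : ∀ i, i + 2 ≤ N → ¬(a (i + 1) = a i + 1 ∧ a (i + 1) = a (i + 2) + 1)) :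
    ∃ j ≤ N, ∀ i ≤ N, a i = a j + Nat.dist i j := by
  unfold Nat.dist
  induction N with
  | zero => exact ⟨0, le_rfl, fun i hi => by simp [Nat.le_zero.1 hi]⟩
  | succ N ih =>
    obtain ⟨j, hj, h⟩ := ih (fun i hi => hstep i (by omega)) (fun i hi => hpeak i (by omega))
    have hN := h N le_rfl
    rcases hstep N (by omega) with hs | hs
    · refine ⟨j, by omega, fun i hi => ?_⟩
      rcases Nat.le_succ_iff.1 hi with hi | rfl
      · exact h i hi
      · rw [Nat.succ_eq_add_one, hs, hN]
        omega
    · have hjN : j = N := by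
        by_contra hne
        obtain ⟨M, rfl⟩ : ∃ M, N = M + 1 := ⟨N - 1, by omega⟩
        have hM := h M (by omega)
        exact hpeak M le_rfl ⟨by omega, hs⟩
      subst hjN
      refine ⟨j + 1, le_rfl, fun i hi => ?_⟩
      rcases Nat.le_succ_iff.1 hi with hi | rfl
      · rw [h i hi]
        omega
      · simp

section Tree

variable {V : Type*} {T : SimpleGraph V}

/-- In a tree, a vertex has at most one neighbour closer to a given root. -/
theorem SimpleGraph.IsTree.eq_of_adj_of_dist_add_one (hT : T.IsTree) {w v u₁ u₂ : V}
    (h₁ : T.Adj u₁ v) (h₂ : T.Adj u₂ v) (hd₁ : T.dist w v = T.dist w u₁ + 1)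
    (hd₂ : T.dist w v = T.dist w u₂ + 1) : u₁ = u₂ := by
  obtain ⟨p, hp⟩ := hT.connected.exists_walk_length_eq_dist w u₁
  obtain ⟨q, hq⟩ := hT.connected.exists_walk_length_eq_dist w u₂
  have hp' := (p.concat h₁).isPath_of_length_eq_dist (by rw [Walk.length_concat, hp, hd₁])
  have hq' := (q.concat h₂).isPath_of_length_eq_dist (by rw [Walk.length_concat, hq, hd₂])
  have := congrArg Subtype.val
    ((hT.isAcyclic.subsingleton_path w v).elim ⟨_, hp'⟩ ⟨_, hq'⟩)
  exact (Walk.concat_inj this).1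

/-- `g 0, …, g N` is a geodesic. -/
def IsGeodesic (T : SimpleGraph V) (g : ℕ → V) (N : ℕ) : Prop :=
  ∀ i ≤ N, ∀ k ≤ N, T.dist (g i) (g k) = Nat.dist i k

theorem IsGeodesic.mono {g : ℕ → V} {M N : ℕ} (hg : IsGeodesic T g N) (hMN : M ≤ N) :
    IsGeodesic T g M :=
  fun i hi k hk => hg i (hi.trans hMN) k (hk.trans hMN)

theorem IsGeodesic.adj {g : ℕ → V} {N i : ℕ} (hg : IsGeodesic T g N) (hi : i < N) :
    T.Adj (g i) (g (i + 1)) := by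
  rw [← dist_eq_one_iff_adj, hg i hi.le (i + 1) hi]
  unfold Nat.dist
  omega

theorem dist_le_of_adj_succ {g : ℕ → V} {i k : ℕ} (hT : T.Connected)
    (hadj : ∀ t < k, T.Adj (g (i + t)) (g (i + t + 1))) : T.dist (g i) (g (i + k)) ≤ k := by
  induction k with
  | zero => simp
  | succ k ih =>
    have h₁ := ih fun t ht => hadj t (by omega)
    have h₂ := dist_eq_one_iff_adj.2 (hadj k (by omega))
    have h₃ := hT.dist_triangle (u := g i) (v := g (i + k)) (w := g (i + k + 1))
    rw [← add_assoc]
    omega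

theorem exists_isGeodesic (hT : T.Connected) (u v : V) :
    ∃ g : ℕ → V, g 0 = u ∧ g (T.dist u v) = v ∧ IsGeodesic T g (T.dist u v) := by
  obtain ⟨p, hp⟩ := hT.exists_walk_length_eq_dist u v
  have hle : ∀ i k, i + k ≤ p.length → T.dist (p.getVert i) (p.getVert (i + k)) ≤ k :=
    fun i k hik => dist_le_of_adj_succ hT fun t ht => p.adj_getVert_succ (by omega)
  have hmono : ∀ i k, i + k ≤ p.length → T.dist (p.getVert i) (p.getVert (i + k)) = k := by
    intro i k hik
    have h₁ := hle 0 i (by omega)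
    have h₂ := hle i k hik
    have h₃ := hle (i + k) (p.length - (i + k)) (by omega)
    rw [Nat.add_sub_cancel' hik, p.getVert_length] at h₃
    rw [zero_add, p.getVert_zero] at h₁
    have h₄ := hT.dist_triangle (u := u) (v := p.getVert i) (w := v)
    have h₅ := hT.dist_triangle (u := p.getVert i) (v := p.getVert (i + k)) (w := v)
    omega
  refine ⟨p.getVert, p.getVert_zero, hp ▸ p.getVert_length, fun i hi k hk => ?_⟩
  rcases le_total i k with h | h
  · obtain ⟨t, rfl⟩ := Nat.exists_eq_add_of_le h
    rw [hmono i t (by omega)]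
    unfold Nat.dist
    omega
  · obtain ⟨t, rfl⟩ := Nat.exists_eq_add_of_le h
    rw [dist_comm, hmono k t (by omega)]
    unfold Nat.dist
    omega

/-- Every vertex of a tree projects onto a geodesic. -/
theorem IsGeodesic.exists_projection (hT : T.IsTree) {g : ℕ → V} {N : ℕ}
    (hg : IsGeodesic T g N) (w : V) :
    ∃ j ≤ N, ∀ i ≤ N, T.dist w (g i) = T.dist w (g j) + Nat.dist i j := by
  refine exists_eq_add_natDist (a := fun i => T.dist w (g i)) (fun i hi => ?_)
    (fun i hi h => ?_)
  · exact (hT.dist_eq_dist_add_one_of_adj w (hg.adj hi)).symm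
  · have h₁ := hT.eq_of_adj_of_dist_add_one (hg.adj (i := i) (by omega))
      (hg.adj (i := i + 1) (by omega)).symm h.1 h.2
    have h₂ := hg i (by omega) (i + 2) hi
    rw [h₁, dist_self] at h₂
    unfold Nat.dist at h₂
    omega

/-- A tree of radius `r` contains a geodesic of length `2r - 1`. -/
theorem exists_isGeodesic_of_graphRadius [Fintype V] (hT : T.IsTree) {r : ℕ}
    (hr : 1 ≤ r) (hrad : graphRadius T = r) : ∃ g : ℕ → V, IsGeodesic T g (2 * r - 1) := by
  have := hT.connected.nonempty
  obtain ⟨⟨u, v⟩, huv⟩ := Finite.exists_max fun x : V × V => T.dist x.1 x.2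
  obtain ⟨g, -, -, hg⟩ := exists_isGeodesic hT.connected u v
  set d := T.dist u v
  by_cases hdr : 2 * r - 1 ≤ d
  · exact ⟨g, hg.mono hdr⟩
  exfalso
  have hecc : ecc T (g (d / 2)) ≤ r - 1 := by
    refine Finset.sup_le fun w _ => ?_
    obtain ⟨j, hj, hproj⟩ := hg.exists_projection hT w
    have h₁ : T.dist w (g 0) ≤ d := huv (w, g 0)
    have h₂ : T.dist w (g d) ≤ d := huv (w, g d)
    have h₃ := hproj 0 (by omega)
    have h₄ := hproj d le_rfl
    rw [dist_comm, hproj (d / 2) (by omega)]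
    unfold Nat.dist at *
    omega
  have : graphRadius T ≤ ecc T (g (d / 2)) := Nat.sInf_le ⟨_, rfl⟩
  omega

end Tree

/-! ### Splitting the Harary index along a path -/

theorem Function.Injective.exists_equiv_extend {V : Type*} [Fintype V] {k m : ℕ} {f : Fin k → V}
    (hf : Function.Injective f) (hcard : Fintype.card V = k + m) :
    ∃ e : Fin k ⊕ Fin m ≃ V, ∀ i, e (Sum.inl i) = f i := by
  classical
  have hc : Fintype.card ((Set.range f)ᶜ : Set V) = m := by
    rw [Fintype.card_compl_set, Set.card_range_of_injective hf, Fintype.card_fin, hcard,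
      Nat.add_sub_cancel_left]
  exact ⟨((Equiv.ofInjective f hf).sumCongr (Fintype.equivFinOfCardEq hc).symm).trans
    (Equiv.Set.sumCompl (Set.range f)), fun i => by simp⟩

theorem SimpleGraph.Hom.edist_le {V W : Type*} {G : SimpleGraph V} {G' : SimpleGraph W}
    (φ : G →g G') (u v : V) : G'.edist (φ u) (φ v) ≤ G.edist u v :=
  le_iInf fun p => by simpa using SimpleGraph.edist_le (p.map φ)

theorem SimpleGraph.Iso.dist_eq {V W : Type*} {G : SimpleGraph V} {G' : SimpleGraph W}
    (φ : G ≃g G') (u v : V) : G'.dist (φ u) (φ v) = G.dist u v := by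
  have h : G.edist (φ.symm (φ u)) (φ.symm (φ v)) ≤ G'.edist (φ u) (φ v) :=
    φ.symm.toHom.edist_le (φ u) (φ v)
  rw [φ.symm_apply_apply, φ.symm_apply_apply] at h
  exact congrArg ENat.toNat (le_antisymm (φ.toHom.edist_le u v) h)

theorem harary_congr {V W : Type*} [Fintype V] [Fintype W] {G : SimpleGraph V}
    {G' : SimpleGraph W} (φ : G ≃g G') : harary G = harary G' := by
  have hdist : ∀ u v, G'.dist (φ.toEquiv u) (φ.toEquiv v) = G.dist u v := φ.dist_eq
  simp only [harary, ← φ.toEquiv.sum_comp, hdist]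
  refine congrArg (· / 2) (sum_congr rfl fun u _ => sum_congr rfl fun v _ => ?_)
  by_cases h : u = v <;> simp [h]

theorem harary_eq_sum {α β V : Type*} [Fintype α] [Fintype β] [Fintype V] [DecidableEq α]
    [DecidableEq β] (G : SimpleGraph V) (e : α ⊕ β ≃ V) :
    harary G =
      (∑ a, ∑ b, if a = b then 0 else (1 : ℝ) / G.dist (e (.inl a)) (e (.inl b))) / 2 +
      ∑ p, ∑ a, (1 : ℝ) / G.dist (e (.inr p)) (e (.inl a)) +
      (∑ p, ∑ q, if p = q then 0 else (1 : ℝ) / G.dist (e (.inr p)) (e (.inr q))) / 2 := by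
  classical
  have h : ∑ a, ∑ p, (1 : ℝ) / G.dist (e (.inl a)) (e (.inr p)) =
      ∑ p, ∑ a, (1 : ℝ) / G.dist (e (.inr p)) (e (.inl a)) := by
    rw [sum_comm]
    simp only [G.dist_comm]
  simp only [harary, ← e.sum_comp, e.injective.eq_iff, Fintype.sum_sum_type, Sum.inl.injEq,
    Sum.inr.injEq, reduceCtorEq, if_false, sum_add_distrib, h]
  ring

/-- The Harary index of a path of length `N` with `m` pendent vertices attached at its
`j`-th vertex. -/
noncomputable def caterpillarIndex (N j m : ℕ) : ℝ :=
  (∑ a : Fin (N + 1), ∑ b : Fin (N + 1),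
    if a = b then 0 else (1 : ℝ) / (Nat.dist a b : ℕ)) / 2 +
  ∑ _p : Fin m, recipSum (N + 1) j 1 +
  (∑ p : Fin m, ∑ q : Fin m, if p = q then 0 else (1 : ℝ) / 2) / 2

theorem caterpillar_adj_inl {n d i : ℕ} {a b : Fin (d + 1)} :
    (caterpillar n d i).Adj (.inl a) (.inl b) ↔ Nat.dist a b = 1 := by
  simp only [caterpillar, fromRel_adj, ne_eq, Sum.inl.injEq, reduceCtorEq, and_false,
    exists_false, or_false, Nat.dist]
  constructor
  · rintro ⟨-, ⟨a', b', rfl, rfl, h⟩ | ⟨a', b', rfl, rfl, h⟩⟩ <;> omega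
  · intro h
    refine ⟨fun hab => by rw [hab] at h; omega, ?_⟩
    rcases lt_or_ge (a : ℕ) b with hab | hab
    · exact .inl ⟨a, b, rfl, rfl, by omega⟩
    · exact .inr ⟨b, a, rfl, rfl, by omega⟩

theorem caterpillar_adj_inl_inr {n d i : ℕ} {a : Fin (d + 1)} {p : Fin (n - d - 1)} :
    (caterpillar n d i).Adj (.inl a) (.inr p) ↔ (a : ℕ) = i := by
  simp [caterpillar, fromRel_adj]

theorem caterpillar_adj_inr {n d i : ℕ} {p q : Fin (n - d - 1)} :
    ¬(caterpillar n d i).Adj (.inr p) (.inr q) := by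
  simp [caterpillar, fromRel_adj]

theorem caterpillar_exists_walk_inl {n d i : ℕ} (a b : Fin (d + 1)) :
    ∃ w : (caterpillar n d i).Walk (.inl a) (.inl b), w.length = Nat.dist a b := by
  have key : ∀ (k : ℕ) (a b : Fin (d + 1)), (b : ℕ) = a + k →
      ∃ w : (caterpillar n d i).Walk (.inl a) (.inl b), w.length = k := by
    intro k
    induction k with
    | zero =>
      intro a b h
      obtain rfl : a = b := Fin.ext (by omega)
      exact ⟨.nil, rfl⟩
    | succ k ih =>
      intro a b h
      obtain ⟨w, hw⟩ := ih a ⟨a + k, by omega⟩ rfl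
      refine ⟨w.concat (caterpillar_adj_inl.2 ?_), by rw [Walk.length_concat, hw]⟩
      simp only [Nat.dist]
      omega
  unfold Nat.dist
  rcases le_total (a : ℕ) b with h | h
  · obtain ⟨w, hw⟩ := key (b - a) a b (by omega)
    exact ⟨w, by omega⟩
  · obtain ⟨w, hw⟩ := key (a - b) b a (by omega)
    exact ⟨w.reverse, by rw [Walk.length_reverse]; omega⟩

theorem one_div_le_one_div_dist {V : Type*} {G : SimpleGraph V} {u v : V} {k : ℕ} (hne : u ≠ v)
    (w : G.Walk u v) (hw : w.length = k) : (1 : ℝ) / k ≤ 1 / G.dist u v := by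
  have hpos := w.reachable.pos_dist_of_ne hne
  apply one_div_le_one_div_of_le
  · exact_mod_cast hpos
  · exact_mod_cast hw ▸ dist_le w

theorem caterpillarIndex_le_harary {n d i : ℕ} (hi : i ≤ d) :
    caterpillarIndex d i (n - d - 1) ≤ harary (caterpillar n d i) := by
  have hadj : ∀ p, (caterpillar n d i).Adj (.inr p) (.inl ⟨i, by omega⟩) :=
    fun p => (caterpillar_adj_inl_inr.2 rfl).symm
  rw [harary_eq_sum _ (Equiv.refl _), caterpillarIndex]
  simp only [Equiv.refl_apply]
  gcongr with a _ b _ p _ p _ q _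
  · split_ifs with h
    · rfl
    · obtain ⟨w, hw⟩ := caterpillar_exists_walk_inl (n := n) (i := i) a b
      exact one_div_le_one_div_dist (by simpa using h) w hw
  · rw [recipSum, ← Fin.sum_univ_eq_sum_range (fun a => 1 / ((1 + Nat.dist a i : ℕ) : ℝ))]
    refine sum_le_sum fun a _ => ?_
    obtain ⟨w, hw⟩ := caterpillar_exists_walk_inl (n := n) (i := i) ⟨i, by omega⟩ a
    refine one_div_le_one_div_dist (by simp) (.cons (hadj p) w) ?_
    rw [Walk.length_cons, hw, Nat.dist_comm, add_comm]
  · split_ifs with h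
    · rfl
    · exact one_div_le_one_div_dist (k := 2) (by simpa using h)
        (.cons (hadj p) (.cons (hadj q).symm .nil)) rfl

section Tree

variable {V : Type*} {T : SimpleGraph V}

theorem one_div_dist_le_half (hT : T.Connected) {u v : V} (hne : u ≠ v) (hadj : ¬T.Adj u v) :
    (1 : ℝ) / T.dist u v ≤ 1 / 2 := by
  apply one_div_le_one_div_of_le two_pos
  exact_mod_cast hT.one_lt_dist_of_ne_of_not_adj hne hadj

/-- `u` is a neighbour of `v` closer to the root `o`. -/
def IsPredecessor (T : SimpleGraph V) (o u v : V) : Prop :=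
  T.Adj u v ∧ T.dist o v = T.dist o u + 1

theorem SimpleGraph.IsTree.isPredecessor_or (hT : T.IsTree) (o : V) {u v : V} (h : T.Adj u v) :
    IsPredecessor T o u v ∨ IsPredecessor T o v u := by
  rcases hT.dist_eq_dist_add_one_of_adj o h with h' | h'
  · exact .inr ⟨h.symm, h'.symm ▸ rfl⟩
  · exact .inl ⟨h, h'.symm ▸ rfl⟩

theorem SimpleGraph.IsTree.isPredecessor_unique (hT : T.IsTree) {o u u' v : V}
    (h : IsPredecessor T o u v) (h' : IsPredecessor T o u' v) : u = u' :=
  hT.eq_of_adj_of_dist_add_one h.1 h'.1 h.2 h'.2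

open Classical in
/-- The contribution of the vertex `f p` to the Harary index, namely its reciprocal distances to
the path `g` plus one half if its predecessor lies in the range of `f`, is largest exactly when
`f p` is attached to one of the two middle vertices of the path. -/
theorem contribution_bound (hT : T.IsTree) {r m : ℕ} (hr : 1 ≤ r) {g : ℕ → V}
    (hg : IsGeodesic T g (2 * r - 1)) {f : Fin m → V} (hf : Function.Injective f)
    (hfg : ∀ p, ∀ i ≤ 2 * r - 1, f p ≠ g i) (p : Fin m) :
    (∑ a : Fin (2 * r - 1 + 1), (1 : ℝ) / T.dist (f p) (g a)) +
        (∑ q, if IsPredecessor T (g 0) (f q) (f p) then (1 : ℝ) else 0) / 2 <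
      recipSum (2 * r) (r - 1) 1 ∨
    (∑ a : Fin (2 * r - 1 + 1), (1 : ℝ) / T.dist (f p) (g a)) +
        (∑ q, if IsPredecessor T (g 0) (f q) (f p) then (1 : ℝ) else 0) / 2 =
      recipSum (2 * r) (r - 1) 1 ∧
    (∀ q, ¬IsPredecessor T (g 0) (f q) (f p)) ∧
    ∃ j, (j = r - 1 ∨ j = r) ∧ ∀ i ≤ 2 * r - 1, T.dist (f p) (g i) = 1 + Nat.dist i j := by
  obtain ⟨j, hj, hproj⟩ := hg.exists_projection hT (f p)
  have hpos := hT.connected.pos_dist_of_ne (hfg p j hj)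
  have hsum : (∑ a : Fin (2 * r - 1 + 1), (1 : ℝ) / T.dist (f p) (g a)) =
      recipSum (2 * r) j (T.dist (f p) (g j)) := by
    rw [Fin.sum_univ_eq_sum_range (fun a => (1 : ℝ) / T.dist (f p) (g a)), recipSum,
      show 2 * r - 1 + 1 = 2 * r by omega]
    refine sum_congr rfl fun i hi => ?_
    rw [mem_range] at hi
    rw [hproj i (by omega)]
  rw [hsum]
  rcases Nat.lt_or_ge 1 (T.dist (f p) (g j)) with h | h
  · left
    have hle : (∑ q, if IsPredecessor T (g 0) (f q) (f p) then (1 : ℝ) else 0) ≤ 1 := by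
      rw [sum_boole]
      have : #{q | IsPredecessor T (g 0) (f q) (f p)} ≤ 1 := by
        rw [card_le_one]
        intro q hq q' hq'
        simp only [mem_filter, mem_univ, true_and] at hq hq'
        exact hf (hT.isPredecessor_unique hq hq')
      exact_mod_cast this
    linarith [recipSum_add_half_lt_middle hr (show j < 2 * r by omega) h]
  · have h1 : T.dist (f p) (g j) = 1 := by omega
    have hpred : IsPredecessor T (g 0) (g j) (f p) := by
      refine ⟨(dist_eq_one_iff_adj.1 h1).symm, ?_⟩
      rw [T.dist_comm, hproj 0 (by omega), hg 0 (by omega) j hj, h1, add_comm]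
    have hnone : ∀ q, ¬IsPredecessor T (g 0) (f q) (f p) :=
      fun q hq => hfg q j hj (hT.isPredecessor_unique hq hpred)
    simp only [hnone, if_false, sum_const_zero, zero_div, add_zero, h1]
    simp only [h1] at hproj
    by_cases hmid : j = r - 1 ∨ j = r
    · refine .inr ⟨?_, fun q => not_false, j, hmid, hproj⟩
      rcases hmid with rfl | rfl
      · rfl
      · exact recipSum_middle hr
    · rw [not_or] at hmid
      exact .inl (recipSum_lt_middle hr (by omega) hmid.1 hmid.2)

theorem harary_le_caterpillarIndex [Fintype V] (hT : T.IsTree) {r m : ℕ} (hr : 1 ≤ r) {g : ℕ → V}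
    (hg : IsGeodesic T g (2 * r - 1)) (e : Fin (2 * r - 1 + 1) ⊕ Fin m ≃ V)
    (he : ∀ i, e (.inl i) = g i) :
    harary T ≤ caterpillarIndex (2 * r - 1) (r - 1) m ∧
    (harary T = caterpillarIndex (2 * r - 1) (r - 1) m →
      (∀ p q, p ≠ q → T.dist (e (.inr p)) (e (.inr q)) = 2) ∧
      ∀ p, ∃ j, (j = r - 1 ∨ j = r) ∧
        ∀ i ≤ 2 * r - 1, T.dist (e (.inr p)) (g i) = 1 + Nat.dist i j) := by
  classical
  set f : Fin m → V := fun p => e (.inr p) with hf_def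
  have hf : Function.Injective f := fun p q h => by simpa [hf_def] using h
  have hfg : ∀ p, ∀ i ≤ 2 * r - 1, f p ≠ g i := by
    intro p i hi h
    have := he ⟨i, by omega⟩
    rw [← h] at this
    simp [hf_def] at this
  have hC := contribution_bound hT hr hg hf hfg
  set c : Fin m → Fin m → ℝ := fun p q => if IsPredecessor T (g 0) (f q) (f p) then 1 else 0
    with hc
  set W : Fin m → ℝ := fun p => ∑ a : Fin (2 * r - 1 + 1), (1 : ℝ) / T.dist (f p) (g a) with hW
  have hpair : ∀ p q, (if p = q then 0 else (1 : ℝ) / T.dist (f p) (f q)) ≤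
      (if p = q then 0 else (1 : ℝ) / 2) + (c p q + c q p) / 2 := by
    intro p q
    have hc0 : ∀ p q, 0 ≤ c p q := fun p q => by
      simp only [hc]
      split_ifs <;> norm_num
    have h₁ := hc0 p q
    have h₂ := hc0 q p
    split_ifs with hpq
    · linarith
    by_cases hadj : T.Adj (f p) (f q)
    · have : 1 ≤ c p q + c q p := by
        rcases hT.isPredecessor_or (g 0) hadj with h | h
        · have : c q p = 1 := if_pos h
          linarith
        · have : c p q = 1 := if_pos h
          linarith
      rw [dist_eq_one_iff_adj.2 hadj]
      norm_num
      linarith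
    · linarith [one_div_dist_le_half hT.connected (hf.ne hpq) hadj]
  have hle : ∀ p, W p + (∑ q, c p q) / 2 ≤ recipSum (2 * r) (r - 1) 1 := fun p =>
    (hC p).elim le_of_lt fun h => h.1.le
  have hsum₁ := sum_le_sum fun p (_ : p ∈ univ) => hle p
  have hsum₂ := sum_le_sum fun p (_ : p ∈ univ) =>
    sum_le_sum fun q (_ : q ∈ univ) => hpair p q
  have hswap : ∑ p, ∑ q, ((if p = q then 0 else (1 : ℝ) / 2) + (c p q + c q p) / 2) =
      (∑ p : Fin m, ∑ q : Fin m, if p = q then 0 else (1 : ℝ) / 2) + ∑ p, ∑ q, c p q := by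
    simp only [sum_add_distrib, ← sum_div]
    rw [sum_comm (f := fun p q => c q p)]
    ring
  have hH : harary T = (∑ a : Fin (2 * r - 1 + 1), ∑ b : Fin (2 * r - 1 + 1),
      if a = b then 0 else (1 : ℝ) / (Nat.dist a b : ℕ)) / 2 + ∑ p, W p +
      (∑ p, ∑ q, if p = q then 0 else (1 : ℝ) / T.dist (f p) (f q)) / 2 := by
    rw [harary_eq_sum T e]
    simp only [he]
    congr 4
    funext a
    refine sum_congr rfl fun b _ => ?_
    rw [hg a (by omega) b (by omega)]
  have hval : caterpillarIndex (2 * r - 1) (r - 1) m =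
      (∑ a : Fin (2 * r - 1 + 1), ∑ b : Fin (2 * r - 1 + 1),
      if a = b then 0 else (1 : ℝ) / (Nat.dist a b : ℕ)) / 2 +
      ∑ _p : Fin m, recipSum (2 * r) (r - 1) 1 +
      (∑ p : Fin m, ∑ q : Fin m, if p = q then 0 else (1 : ℝ) / 2) / 2 := by
    rw [caterpillarIndex]
    rw [show 2 * r - 1 + 1 = 2 * r by omega]
  rw [sum_add_distrib, ← sum_div] at hsum₁
  rw [hswap] at hsum₂
  refine ⟨by linarith, fun heq => ?_⟩
  have heq₁ : ∑ p, (W p + (∑ q, c p q) / 2) = ∑ _p : Fin m, recipSum (2 * r) (r - 1) 1 := by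
    rw [sum_add_distrib, ← sum_div]
    linarith
  have hall : ∀ p, (∀ q, ¬IsPredecessor T (g 0) (f q) (f p)) ∧ ∃ j, (j = r - 1 ∨ j = r) ∧
      ∀ i ≤ 2 * r - 1, T.dist (f p) (g i) = 1 + Nat.dist i j := by
    intro p
    have h := (sum_eq_sum_iff_of_le fun p _ => hle p).1 heq₁ p (mem_univ p)
    exact ((hC p).resolve_left h.not_lt).2
  refine ⟨fun p q hpq => ?_, fun p => (hall p).2⟩
  have heq₂ : ∑ p, ∑ q, (if p = q then 0 else (1 : ℝ) / T.dist (f p) (f q)) =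
      ∑ p, ∑ q, ((if p = q then 0 else (1 : ℝ) / 2) + (c p q + c q p) / 2) := by
    rw [hswap]
    linarith
  have h₁ := (sum_eq_sum_iff_of_le fun p _ => sum_le_sum fun q _ => hpair p q).1 heq₂ p
    (mem_univ p)
  have h₂ := (sum_eq_sum_iff_of_le fun q _ => hpair p q).1 h₁ q (mem_univ q)
  simp only [hc, (hall p).1 q, (hall q).1 p, if_false, hpq, add_zero, zero_div, one_div,
    inv_inj] at h₂
  exact_mod_cast h₂

/-- Recognising a caterpillar from distances. -/
theorem nonempty_iso_caterpillar {n d i : ℕ} (e : Fin (d + 1) ⊕ Fin (n - d - 1) ≃ V)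
    (hll : ∀ a b : Fin (d + 1), T.dist (e (.inl a)) (e (.inl b)) = Nat.dist a b)
    (hrl : ∀ p (a : Fin (d + 1)), T.dist (e (.inr p)) (e (.inl a)) = 1 + Nat.dist a i)
    (hrr : ∀ p q, p ≠ q → T.dist (e (.inr p)) (e (.inr q)) = 2) :
    Nonempty (T ≃g caterpillar n d i) := by
  have hrl' : ∀ p (a : Fin (d + 1)), T.Adj (e (.inr p)) (e (.inl a)) ↔ (a : ℕ) = i := by
    intro p a
    rw [← dist_eq_one_iff_adj, hrl]
    unfold Nat.dist
    omega
  refine ⟨(RelIso.mk e ?_ : caterpillar n d i ≃g T).symm⟩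
  rintro (a | p) (b | q)
  · rw [caterpillar_adj_inl, ← dist_eq_one_iff_adj, hll]
  · rw [caterpillar_adj_inl_inr, adj_comm, hrl']
  · rw [hrl', adj_comm, caterpillar_adj_inl_inr]
  · refine iff_of_false (fun h => ?_) caterpillar_adj_inr
    have := hrr p q fun h' => h.ne (by rw [h'])
    rw [dist_eq_one_iff_adj.2 h] at this
    omega

theorem SimpleGraph.IsTree.even_dist_add_dist_of_dist_eq_two (hT : T.IsTree) {u v : V}
    (h : T.dist u v = 2) (o : V) : Even (T.dist o u + T.dist o v) := by
  obtain ⟨g, hu, hv, hg⟩ := exists_isGeodesic hT.connected u v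
  rw [h] at hv hg
  have h₁ := hT.dist_eq_dist_add_one_of_adj o (hg.adj (i := 0) (by omega))
  have h₂ := hT.dist_eq_dist_add_one_of_adj o (hg.adj (i := 1) (by omega))
  rw [hu] at h₁
  rw [hv] at h₂
  rw [Nat.even_iff]
  rw [zero_add] at h₁
  omega

end Tree

theorem harary_radius_max {V : Type*} [Fintype V] (T : SimpleGraph V) (hT : T.IsTree)
    (n r : ℕ) (hr : 2 ≤ r) (hn : 2 * r ≤ n) (hcard : Fintype.card V = n)
    (hrad : graphRadius T = r) :
    harary T ≤ harary (caterpillar n (2 * r - 1) (r - 1)) ∧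
    (harary T = harary (caterpillar n (2 * r - 1) (r - 1)) ↔
      Nonempty (T ≃g caterpillar n (2 * r - 1) (r - 1))) := by
  obtain ⟨g, hg⟩ := exists_isGeodesic_of_graphRadius hT (by omega) hrad
  have hinj : Function.Injective fun i : Fin (2 * r - 1 + 1) => g i := by
    intro a b hab
    have h := hg a (by omega) b (by omega)
    simp only at hab
    rw [hab, dist_self] at h
    exact Fin.ext (Nat.eq_of_dist_eq_zero h.symm)
  obtain ⟨e, he⟩ := hinj.exists_equiv_extend (m := n - (2 * r - 1) - 1) (by omega)
  obtain ⟨hle, heq⟩ := harary_le_caterpillarIndex hT (by omega) hg e he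
  have hge := caterpillarIndex_le_harary (n := n) (d := 2 * r - 1) (i := r - 1) (by omega)
  refine ⟨hle.trans hge, fun h => ?_, fun ⟨φ⟩ => harary_congr φ⟩
  obtain ⟨hrr, hattach⟩ := heq (le_antisymm hle (h ▸ hge))
  have hsame : ∃ j, (j = r - 1 ∨ j = r) ∧ ∀ p, ∀ i ≤ 2 * r - 1,
      T.dist (e (.inr p)) (g i) = 1 + Nat.dist i j := by
    rcases isEmpty_or_nonempty (Fin (n - (2 * r - 1) - 1)) with _ | ⟨⟨p₀⟩⟩
    · exact ⟨r, .inr rfl, isEmptyElim⟩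
    obtain ⟨j₀, hj₀, h₀⟩ := hattach p₀
    refine ⟨j₀, hj₀, fun p => ?_⟩
    obtain ⟨j, hj, hp⟩ := hattach p
    obtain rfl : j = j₀ := by
      by_cases hpp : p = p₀
      · subst hpp
        have h₁ := h₀ j₀ (by omega)
        rw [hp j₀ (by omega), Nat.dist_self] at h₁
        exact (Nat.eq_of_dist_eq_zero (by omega)).symm
      · have hev := hT.even_dist_add_dist_of_dist_eq_two (hrr p p₀ hpp) (g 0)
        rw [T.dist_comm, hp 0 (by omega), T.dist_comm (u := g 0), h₀ 0 (by omega),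
          Nat.even_iff] at hev
        unfold Nat.dist at hev
        omega
    exact hp
  obtain ⟨j, rfl | rfl, hj⟩ := hsame
  · refine nonempty_iso_caterpillar e (fun a b => ?_) (fun p a => ?_) hrr
    · rw [he, he, hg a (by omega) b (by omega)]
    · rw [he, hj p a (by omega)]
  · refine nonempty_iso_caterpillar ((Fin.revPerm.sumCongr (Equiv.refl _)).trans e)
      (fun a b => ?_) (fun p a => ?_) hrr
    · simp only [Equiv.trans_apply, Equiv.sumCongr_apply, Sum.map_inl, Fin.revPerm_apply, he]
      rw [hg _ (by omega) _ (by omega), Fin.val_rev, Fin.val_rev]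
      unfold Nat.dist
      omega
    · simp only [Equiv.trans_apply, Equiv.sumCongr_apply, Sum.map_inl, Sum.map_inr,
        Equiv.refl_apply, Fin.revPerm_apply, he]
      rw [hj p _ (by omega), Fin.val_rev]
      unfold Nat.dist
      omega
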